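/- arXiv:nlin/0603028 — 2 statements merged into one kernel-verified Lean document; each statement's English description precedes it below -/
import Mathlib

section
/- The operator-valued polynomial B_n generates a commuting family: for all λ, μ ∈ ℂ, B_n(λ) ∘ B_n(μ) = B_n(μ) ∘ B_n(λ) as operators on V^(n). -/
open scoped BigOperators

noncomputable section

/-- The `n`-site quantum space of the Baxter–Bazhanov–Stroganov model:
functions `(Fin n → ZMod N) → ℂ`. -/
abbrev BBSV (N n : ℕ) : Type := (Fin n → ZMod N) → ℂ

/-- Weyl operator `u_k`, acting diagonally by `ω^{γ_k}` on the basis vector `|γ⟩`. -/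
def Uop (N : ℕ) (ω : ℂ) {n : ℕ} (k : Fin n) : Module.End ℂ (BBSV N n) where
  toFun f := fun γ => ω ^ (γ k).val * f γ
  map_add' f g := by funext γ; simp [mul_add]
  map_smul' r f := by
    funext γ
    simp only [Pi.smul_apply, smul_eq_mul, RingHom.id_apply]
    ring

/-- Weyl operator `u_k⁻¹`, acting diagonally by `ω^{-γ_k}` on the basis vector `|γ⟩`. -/
def Uinv (N : ℕ) (ω : ℂ) {n : ℕ} (k : Fin n) : Module.End ℂ (BBSV N n) where
  toFun f := fun γ => ω ^ (-(γ k)).val * f γ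
  map_add' f g := by funext γ; simp [mul_add]
  map_smul' r f := by
    funext γ
    simp only [Pi.smul_apply, smul_eq_mul, RingHom.id_apply]
    ring

/-- Weyl operator `v_k`, mapping `|γ⟩` to `|γ + e_k⟩`. -/
def Vop (N : ℕ) {n : ℕ} (k : Fin n) : Module.End ℂ (BBSV N n) where
  toFun f := fun γ => f (fun j => γ j - if j = k then 1 else 0)
  map_add' f g := rfl
  map_smul' r f := rfl

/-- The cyclic L-operator at site `k` with parameters `A B C D K`, a `2×2` matrix over
`End(V^(n))`. -/
def Lop (N : ℕ) (ω : ℂ) {n : ℕ} (A B C D K : ℂ) (k : Fin n) (lam : ℂ) :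
    Matrix (Fin 2) (Fin 2) (Module.End ℂ (BBSV N n)) :=
  !![1 + (lam * K) • Vop N k,
     lam • (Uinv N ω k * (A • (1 : Module.End ℂ (BBSV N n)) - B • Vop N k));
     Uop N ω k * (C • (1 : Module.End ℂ (BBSV N n)) - D • Vop N k),
     (lam * A * C) • (1 : Module.End ℂ (BBSV N n)) + (B * D / K) • Vop N k]

/-- The monodromy matrix `T_n(λ) = L_1(λ) ⋯ L_n(λ)` (sites `1,…,n` are indexed by
`0,…,n-1`, the parameters being functions on `ℕ`). -/
def Tmat (N : ℕ) (ω : ℂ) (a b c d κ : ℕ → ℂ) (n : ℕ) (lam : ℂ) :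
    Matrix (Fin 2) (Fin 2) (Module.End ℂ (BBSV N n)) :=
  ((List.finRange n).map
    (fun k => Lop N ω (a k.val) (b k.val) (c k.val) (d k.val) (κ k.val) k lam)).prod


section YangBaxter

variable {R : Type*} [Ring R]

/-- The tensor product `T ⊗ S` of two `2×2` operator matrices, with operator products in the order
`T S`. -/
def tensorLeft (T S : Matrix (Fin 2) (Fin 2) R) : Matrix (Fin 2 × Fin 2) (Fin 2 × Fin 2) R :=
  fun i j => T i.1 j.1 * S i.2 j.2

/-- The tensor product `T ⊗ S` of two `2×2` operator matrices, with operator products in the order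
`S T`. -/
def tensorRight (T S : Matrix (Fin 2) (Fin 2) R) : Matrix (Fin 2 × Fin 2) (Fin 2 × Fin 2) R :=
  fun i j => S i.2 j.2 * T i.1 j.1

theorem tensorLeft_mul {T₁ T₂ S₁ S₂ : Matrix (Fin 2) (Fin 2) R}
    (h : ∀ i j k l, Commute (T₂ i j) (S₁ k l)) :
    tensorLeft (T₁ * T₂) (S₁ * S₂) = tensorLeft T₁ S₁ * tensorLeft T₂ S₂ := by
  ext ⟨i, j⟩ ⟨p, q⟩
  simp only [tensorLeft, Matrix.mul_apply, Fintype.sum_prod_type, Finset.sum_mul_sum]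
  refine Finset.sum_congr rfl fun m _ => Finset.sum_congr rfl fun l _ => ?_
  exact (h m p j l).mul_mul_mul_comm _ _

theorem tensorRight_mul {T₁ T₂ S₁ S₂ : Matrix (Fin 2) (Fin 2) R}
    (h : ∀ i j k l, Commute (S₂ i j) (T₁ k l)) :
    tensorRight (T₁ * T₂) (S₁ * S₂) = tensorRight T₁ S₁ * tensorRight T₂ S₂ := by
  ext ⟨i, j⟩ ⟨p, q⟩
  simp only [tensorRight, Matrix.mul_apply, Fintype.sum_prod_type, Finset.sum_mul_sum]
  rw [Finset.sum_comm]
  refine Finset.sum_congr rfl fun m _ => Finset.sum_congr rfl fun l _ => ?_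
  exact (h l q i m).mul_mul_mul_comm _ _

theorem commute_list_prod_apply {ι : Type*} {f g : ι → Matrix (Fin 2) (Fin 2) R} {s : List ι}
    {k : ι}
    (h : ∀ m ∈ s, ∀ i j p q, Commute (f m i j) (g k p q)) (i j p q : Fin 2) :
    Commute ((s.map f).prod i j) (g k p q) := by
  induction s generalizing i j with
  | nil =>
    rw [List.map_nil, List.prod_nil, Matrix.one_apply]
    split_ifs
    exacts [Commute.one_left _, Commute.zero_left _]
  | cons m s ih =>
    rw [List.map_cons, List.prod_cons, Matrix.mul_apply]
    exact Commute.sum_left _ _ _ fun l _ => (h m (by simp) i l p q).mul_left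
      (ih (fun m' hm' => h m' (by simp [hm'])) l j)

variable [Algebra ℂ R]

/-- The twisted six-vertex `R`-matrix. -/
def sixVertex (ω x y : ℂ) : Matrix (Fin 2 × Fin 2) (Fin 2 × Fin 2) ℂ :=
  fun i j => !![x - ω * y, 0, 0, 0;
    0, ω * (x - y), x * (1 - ω), 0;
    0, y * (1 - ω), x - y, 0;
    0, 0, 0, x - ω * y] (finProdFinEquiv i) (finProdFinEquiv j)

/-- The relation `R(x, y) T₁ S₂ = S₂ T₁ R(x, y)`. -/
def RTT (ω x y : ℂ) (T S : Matrix (Fin 2) (Fin 2) R) : Prop :=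
  (sixVertex ω x y).map (algebraMap ℂ R) * tensorLeft T S =
    tensorRight T S * (sixVertex ω x y).map (algebraMap ℂ R)

theorem RTT.mul {ω x y : ℂ} {T₁ T₂ S₁ S₂ : Matrix (Fin 2) (Fin 2) R}
    (h₁ : RTT ω x y T₁ S₁) (h₂ : RTT ω x y T₂ S₂)
    (hTS : ∀ i j k l, Commute (T₂ i j) (S₁ k l)) (hST : ∀ i j k l, Commute (S₂ i j) (T₁ k l)) :
    RTT ω x y (T₁ * T₂) (S₁ * S₂) := by
  unfold RTT at *
  rw [tensorLeft_mul hTS, tensorRight_mul hST, ← mul_assoc, h₁, mul_assoc, h₂, mul_assoc]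

theorem RTT.one (ω x y : ℂ) : RTT ω x y (1 : Matrix (Fin 2) (Fin 2) R) 1 := by
  have hl : tensorLeft (1 : Matrix (Fin 2) (Fin 2) R) 1 = 1 := by
    ext ⟨i, j⟩ ⟨p, q⟩
    fin_cases i <;> fin_cases j <;> fin_cases p <;> fin_cases q <;>
      simp [tensorLeft]
  have hr : tensorRight (1 : Matrix (Fin 2) (Fin 2) R) 1 = 1 := by
    ext ⟨i, j⟩ ⟨p, q⟩
    fin_cases i <;> fin_cases j <;> fin_cases p <;> fin_cases q <;>
      simp [tensorRight]
  rw [RTT, hl, hr, mul_one, one_mul]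

theorem RTT.commute {ω x y : ℂ} {T S : Matrix (Fin 2) (Fin 2) R} (h : RTT ω x y T S)
    (hxy : x ≠ ω * y) : Commute (T 0 1) (S 0 1) := by
  have e := congrFun (congrFun h (0, 0)) (1, 1)
  simp only [Matrix.mul_apply, Fintype.sum_prod_type, Fin.sum_univ_two, Matrix.map_apply] at e
  simp [sixVertex, finProdFinEquiv, tensorLeft, tensorRight, -map_mul, -map_sub,
    ← Algebra.commutes, ← Algebra.smul_def] at e
  exact smul_right_injective R (sub_ne_zero.2 hxy) e

theorem RTT.list_prod {ι : Type*} {ω x y : ℂ} {f g : ι → Matrix (Fin 2) (Fin 2) R} {s : List ι}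
    (hs : s.Nodup) (hfg : ∀ k m, k ≠ m → ∀ i j p q, Commute (f k i j) (g m p q))
    (h : ∀ k, RTT ω x y (f k) (g k)) :
    RTT ω x y (s.map f).prod (s.map g).prod := by
  induction s with
  | nil => exact RTT.one ω x y
  | cons k s ih =>
    rw [List.nodup_cons] at hs
    have hne : ∀ m ∈ s, m ≠ k := fun m hm e => hs.1 (e ▸ hm)
    simp only [List.map_cons, List.prod_cons]
    exact (h k).mul (ih hs.2) (commute_list_prod_apply fun m hm => hfg m k (hne m hm))
      (commute_list_prod_apply fun m hm i j p q => (hfg k m (hne m hm).symm p q i j).symm)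

/-- The cyclic `L`-operator built from an abstract Weyl triple `u`, `ui`, `v`. -/
def weylL (u ui v : R) (A B C D K x : ℂ) : Matrix (Fin 2) (Fin 2) R :=
  !![1 + (x * K) • v, x • (ui * (A • (1 : R) - B • v));
     u * (C • (1 : R) - D • v), (x * A * C) • (1 : R) + (B * D / K) • v]

theorem weylL_commute {u ui v z : R} (hu : Commute u z) (hui : Commute ui z) (hv : Commute v z)
    (A B C D K x : ℂ) (i j : Fin 2) : Commute (weylL u ui v A B C D K x i j) z := by
  have hl (r s : ℂ) : Commute (r • (1 : R) - s • v) z :=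
    ((Commute.one_left z).smul_left r).sub_left (hv.smul_left s)
  fin_cases i <;> fin_cases j
  · exact (Commute.one_left z).add_left (hv.smul_left (x * K))
  · exact (hui.mul_left (hl A B)).smul_left x
  · exact hu.mul_left (hl C D)
  · exact ((Commute.one_left z).smul_left (x * A * C)).add_left (hv.smul_left (B * D / K))

theorem weylL_rtt {u ui v : R} {ω A B C D K x y : ℂ} (hω : ω ≠ 0) (hK : K ≠ 0)
    (h₁ : u * ui = 1) (h₂ : ui * u = 1) (h₃ : v * u = ω⁻¹ • (u * v)) (h₄ : v * ui = ω • (ui * v)) :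
    RTT ω x y (weylL u ui v A B C D K x) (weylL u ui v A B C D K y) := by
  have h₁' (z : R) : u * (ui * z) = z := by rw [← mul_assoc, h₁, one_mul]
  have h₂' (z : R) : ui * (u * z) = z := by rw [← mul_assoc, h₂, one_mul]
  have h₃' (z : R) : v * (u * z) = ω⁻¹ • (u * (v * z)) := by
    rw [← mul_assoc, h₃, smul_mul_assoc, mul_assoc]
  have h₄' (z : R) : v * (ui * z) = ω • (ui * (v * z)) := by
    rw [← mul_assoc, h₄, smul_mul_assoc, mul_assoc]
  unfold RTT
  ext ⟨i, j⟩ ⟨p, q⟩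
  simp only [Matrix.mul_apply, Fintype.sum_prod_type, Fin.sum_univ_two, Matrix.map_apply,
    ← Algebra.commutes, ← Algebra.smul_def]
  fin_cases i <;> fin_cases j <;> fin_cases p <;> fin_cases q <;>
    simp [-map_sub, -map_mul, sixVertex, finProdFinEquiv, tensorLeft, tensorRight, weylL, mul_add,
      add_mul, mul_sub, sub_mul, mul_assoc, h₁, h₂, h₃, h₄, h₁', h₂', h₃', h₄'] <;>
    match_scalars <;> field_simp <;> ring

end YangBaxter

theorem pow_val_add {N : ℕ} [NeZero N] {ω : ℂ} (hω : ω ^ N = 1) (x y : ZMod N) :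
    ω ^ (x + y).val = ω ^ x.val * ω ^ y.val := by
  rw [ZMod.val_add, ← pow_eq_pow_mod _ hω, pow_add]

theorem pow_val_sub_one {N : ℕ} [NeZero N] [Fact (1 < N)] {ω : ℂ} (hω : ω ^ N = 1) (x : ZMod N) :
    ω * ω ^ (x - 1).val = ω ^ x.val := by
  have h := pow_val_add hω (x - 1) 1
  rw [sub_add_cancel, ZMod.val_one, pow_one] at h
  rw [h, mul_comm]

section Weyl

variable {N n : ℕ} {ω : ℂ}

theorem Uop_mul_Uinv [NeZero N] (hω : ω ^ N = 1) (k : Fin n) : Uop N ω k * Uinv N ω k = 1 := by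
  refine LinearMap.ext fun f => funext fun γ => ?_
  change ω ^ (γ k).val * (ω ^ (-(γ k)).val * f γ) = f γ
  rw [← mul_assoc, ← pow_val_add hω]
  simp

theorem Uop_commute_Uinv (k m : Fin n) : Commute (Uop N ω k) (Uinv N ω m) := by
  refine LinearMap.ext fun f => funext fun γ => ?_
  exact mul_left_comm _ _ _

theorem Uop_commute (k m : Fin n) : Commute (Uop N ω k) (Uop N ω m) := by
  refine LinearMap.ext fun f => funext fun γ => ?_
  exact mul_left_comm _ _ _

theorem Uinv_commute (k m : Fin n) : Commute (Uinv N ω k) (Uinv N ω m) := by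
  refine LinearMap.ext fun f => funext fun γ => ?_
  exact mul_left_comm _ _ _

theorem Vop_commute (k m : Fin n) : Commute (Vop N k) (Vop N m) := by
  refine LinearMap.ext fun f => funext fun γ => ?_
  exact congrArg f (funext fun j => sub_right_comm _ _ _)

theorem Uop_commute_Vop {k m : Fin n} (h : k ≠ m) : Commute (Uop N ω k) (Vop N m) := by
  refine LinearMap.ext fun f => funext fun γ => ?_
  change _ = ω ^ (γ k - if k = m then 1 else 0).val * _
  rw [if_neg h, sub_zero]
  rfl

theorem Uinv_commute_Vop {k m : Fin n} (h : k ≠ m) : Commute (Uinv N ω k) (Vop N m) := by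
  refine LinearMap.ext fun f => funext fun γ => ?_
  change _ = ω ^ (-(γ k - if k = m then 1 else 0)).val * _
  rw [if_neg h, sub_zero]
  rfl

theorem Vop_mul_Uop [NeZero N] [Fact (1 < N)] (hω : ω ^ N = 1) (h0 : ω ≠ 0) (k : Fin n) :
    Vop N k * Uop N ω k = ω⁻¹ • (Uop N ω k * Vop N k) := by
  refine LinearMap.ext fun f => funext fun γ => ?_
  change ω ^ (γ k - if k = k then 1 else 0).val * f _ = ω⁻¹ * (ω ^ (γ k).val * f _)
  rw [if_pos rfl, ← pow_val_sub_one hω (γ k), mul_assoc, inv_mul_cancel_left₀ h0]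

theorem Vop_mul_Uinv [NeZero N] [Fact (1 < N)] (hω : ω ^ N = 1) (k : Fin n) :
    Vop N k * Uinv N ω k = ω • (Uinv N ω k * Vop N k) := by
  refine LinearMap.ext fun f => funext fun γ => ?_
  change ω ^ (-(γ k - if k = k then 1 else 0)).val * f _ = ω * (ω ^ (-(γ k)).val * f _)
  have h := pow_val_sub_one hω (-(γ k - 1))
  rw [neg_sub, sub_right_comm, sub_self, zero_sub] at h
  rw [if_pos rfl, neg_sub, ← h, mul_assoc]

theorem Lop_commute {k m : Fin n} (h : k ≠ m) (A B C D K A' B' C' D' K' x y : ℂ) (i j p q : Fin 2) :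
    Commute (Lop N ω A B C D K k x i j) (Lop N ω A' B' C' D' K' m y p q) := by
  refine weylL_commute (Commute.symm ?_) (Commute.symm ?_) (Commute.symm ?_) A B C D K x i j
  · exact weylL_commute (Uop_commute m k) (Uop_commute_Uinv k m).symm (Uop_commute_Vop h).symm
      A' B' C' D' K' y p q
  · exact weylL_commute (Uop_commute_Uinv m k) (Uinv_commute m k) (Uinv_commute_Vop h).symm
      A' B' C' D' K' y p q
  · exact weylL_commute (Uop_commute_Vop h.symm) (Uinv_commute_Vop h.symm) (Vop_commute m k)
      A' B' C' D' K' y p q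

theorem Tmat_rtt [NeZero N] [Fact (1 < N)] (hω : ω ^ N = 1) (h0 : ω ≠ 0) {a b c d κ : ℕ → ℂ}
    (hκ : ∀ k < n, κ k ≠ 0) (x y : ℂ) :
    RTT ω x y (Tmat N ω a b c d κ n x) (Tmat N ω a b c d κ n y) :=
  RTT.list_prod (List.nodup_finRange n) (fun _ _ h => Lop_commute h _ _ _ _ _ _ _ _ _ _ _ _)
    fun k => weylL_rtt h0 (hκ k k.2) (Uop_mul_Uinv hω k)
      ((Uop_commute_Uinv k k).eq ▸ Uop_mul_Uinv hω k) (Vop_mul_Uop hω h0 k) (Vop_mul_Uinv hω k)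

theorem continuous_Tmat_apply [NeZero N] (a b c d κ : ℕ → ℂ) (i j : Fin 2) :
    Continuous fun x : ℂ =>
      Module.End.toContinuousLinearMap (BBSV N n) (Tmat N ω a b c d κ n x i j) := by
  unfold Tmat
  induction List.finRange n generalizing i j with
  | nil => simp only [List.map_nil, List.prod_nil]; fun_prop
  | cons k s ih =>
    simp only [List.map_cons, List.prod_cons, Matrix.mul_apply, map_sum, map_mul]
    refine continuous_finsetSum _ fun m _ => Continuous.mul ?_ (ih m j)
    fin_cases i <;> fin_cases m <;> simp [Lop] <;> fun_prop

end Weyl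

/-- The operator-valued polynomial `B_n` generates a commuting family:
`B_n(λ) ∘ B_n(μ) = B_n(μ) ∘ B_n(λ)` on `V^(n)`. -/
theorem bbs_B_commute
    (N : ℕ) (hN : 2 ≤ N) (n : ℕ) (hn : 1 ≤ n)
    (ω : ℂ) (hω : ω = Complex.exp (2 * Real.pi * Complex.I / N))
    (a b c d κ : ℕ → ℂ) (hκ : ∀ k < n, κ k ≠ 0)
    (lam mu : ℂ) :
    Tmat N ω a b c d κ n lam 0 1 * Tmat N ω a b c d κ n mu 0 1 =
      Tmat N ω a b c d κ n mu 0 1 * Tmat N ω a b c d κ n lam 0 1 := by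
  have hN0 : N ≠ 0 := by omega
  have : NeZero N := ⟨hN0⟩
  have : Fact (1 < N) := ⟨hN⟩
  have h0 : ω ≠ 0 := hω ▸ Complex.exp_ne_zero _
  have hω1 : ω ^ N = 1 := hω ▸ (Complex.isPrimitiveRoot_exp N hN0).pow_eq_one
  have hB := continuous_Tmat_apply (N := N) (n := n) (ω := ω) a b c d κ 0 1
  apply (Module.End.toContinuousLinearMap (BBSV N n)).injective
  rw [map_mul, map_mul]
  refine congrFun (Continuous.ext_on (dense_compl_singleton (ω * mu))
    (hB.mul continuous_const) (continuous_const.mul hB) fun x hx => ?_) lam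
  have h := ((Tmat_rtt (a := a) (b := b) (c := c) (d := d) hω1 h0 hκ x mu).commute hx).eq
  simpa only [Pi.mul_apply, map_mul] using congrArg (Module.End.toContinuousLinearMap (BBSV N n)) h
end
end

section
/- The vectors ψ_ρ are eigenvectors of the upper off-diagonal entry of the one-site L-operator: under the stated hypotheses, for every ρ ∈ ZMod N one has u^{-1}(a·id − b·v)ψ_ρ = a x ω^{-ρ} ψ_ρ in ℂ^{ZMod N}, where ψ_ρ = Σ_{γ ∈ ZMod N} w_{(x, b/a)}(γ − ρ)|γ⟩. -/
open scoped BigOperators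

noncomputable section

/-- Weyl operator `u⁻¹` on the single-site space `ℂ^{ZMod N}`: `u⁻¹|γ⟩ = ω^{−γ}|γ⟩`. -/
def U1inv (N : ℕ) (ω : ℂ) : Module.End ℂ (ZMod N → ℂ) where
  toFun f := fun γ => ω ^ (-γ).val * f γ
  map_add' f g := by funext γ; simp [mul_add]
  map_smul' r f := by
    funext γ
    simp only [Pi.smul_apply, smul_eq_mul, RingHom.id_apply]
    ring

/-- Weyl operator `v` on the single-site space: `v|γ⟩ = |γ+1⟩`. -/
def V1 (N : ℕ) : Module.End ℂ (ZMod N → ℂ) where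
  toFun f := fun γ => f (γ - 1)
  map_add' f g := rfl
  map_smul' r f := rfl

/-- Auxiliary recursion for the cyclic function `w_p`:
`wrec 0 = 1`, `wrec (m+1) = wrec m · y/(1 − ω^{m+1} x)`. -/
def wrec (ω x y : ℂ) : ℕ → ℂ
  | 0 => 1
  | m + 1 => wrec ω x y m * (y / (1 - ω ^ (m + 1) * x))

/-- The cyclic function `w_p : ZMod N → ℂ` attached to a Fermat-curve point `p = (x, y)`,
determined by `w_p(0) = 1` and `w_p(γ)/w_p(γ−1) = y/(1 − ω^γ x)`. -/
def wfun (N : ℕ) (ω : ℂ) (p : ℂ × ℂ) (γ : ZMod N) : ℂ := wrec ω p.1 p.2 γ.val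

/-- Exponents in `ZMod N` of an `N`-th root of unity add. -/
theorem pow_zmod_val_add {N : ℕ} [NeZero N] {ω : ℂ} (h : ω ^ N = 1) (α β : ZMod N) :
    ω ^ (α + β).val = ω ^ α.val * ω ^ β.val := by
  rw [ZMod.val_add, ← pow_add]
  exact (pow_eq_pow_mod _ h).symm

theorem one_sub_pow_mul_ne_zero {N : ℕ} {ω x : ℂ} (h : ω ^ N = 1) (hx : x ^ N ≠ 1) (k : ℕ) :
    1 - ω ^ k * x ≠ 0 := by
  intro h0
  have h1 : (ω ^ k * x) ^ N = 1 := by rw [← sub_eq_zero.mp h0, one_pow]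
  rw [mul_pow, pow_right_comm, h, one_pow, one_mul] at h1
  exact hx h1

theorem wrec_mul_prod {ω x : ℂ} (y : ℂ) (h : ∀ k : ℕ, 1 - ω ^ k * x ≠ 0) (m : ℕ) :
    wrec ω x y m * ∏ k ∈ Finset.range m, (1 - ω ^ (k + 1) * x) = y ^ m := by
  induction m with
  | zero => simp [wrec]
  | succ m ih =>
    have := h (m + 1)
    rw [Finset.prod_range_succ, wrec, pow_succ y, ← ih]
    field_simp

theorem one_sub_pow_eq_prod {N : ℕ} {ω : ℂ} (h : IsPrimitiveRoot ω N) (hN : 0 < N) (x : ℂ) :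
    1 - x ^ N = ∏ k ∈ Finset.range N, (1 - ω ^ k * x) := by
  have := congrArg (Polynomial.eval 1) (X_pow_sub_C_eq_prod h hN (rfl : x ^ N = x ^ N))
  simpa [Polynomial.eval_prod] using this

/-- The recurrence of the cyclic function holds on all of `ZMod N`, including across `γ = 0`. -/
theorem wfun_mul_one_sub {N : ℕ} [NeZero N] {ω : ℂ} (h : IsPrimitiveRoot ω N) {x y : ℂ}
    (hxy : x ^ N + y ^ N = 1) (hx : x ^ N ≠ 1) (γ : ZMod N) :
    wfun N ω (x, y) γ * (1 - ω ^ γ.val * x) = y * wfun N ω (x, y) (γ - 1) := by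
  have hne := one_sub_pow_mul_ne_zero h.pow_eq_one hx
  obtain ⟨n, rfl⟩ := Nat.exists_eq_succ_of_ne_zero (NeZero.ne N)
  by_cases hγ : γ = 0
  · subst hγ
    have hprod : ∏ k ∈ Finset.range n, (1 - ω ^ (k + 1) * x) ≠ 0 :=
      Finset.prod_ne_zero_iff.mpr fun k _ => hne (k + 1)
    have h1 := one_sub_pow_eq_prod h n.succ_pos x
    rw [Nat.succ_eq_add_one, Finset.prod_range_succ', pow_zero, one_mul] at h1
    have h2 := wrec_mul_prod y hne n
    simp only [wfun, zero_sub, ZMod.val_neg_one, ZMod.val_zero, wrec, pow_zero, one_mul]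
    refine mul_left_cancel₀ hprod ?_
    rw [← h1, ← eq_sub_of_add_eq' hxy, pow_succ, ← h2]
    ring
  · obtain ⟨m, hm⟩ := Nat.exists_eq_succ_of_ne_zero ((ZMod.val_ne_zero γ).mpr hγ)
    have hm' : (γ - 1).val = m := by
      have hlt := ZMod.val_lt γ
      have hcast : γ - 1 = (m : ZMod (n + 1)) := by
        rw [← ZMod.natCast_zmod_val γ, hm]
        push_cast
        ring
      rw [hcast, ZMod.val_natCast, Nat.mod_eq_of_lt (by omega)]
    have := hne (m + 1)
    simp only [wfun, hm', hm, wrec, Nat.succ_eq_add_one]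
    field_simp

/-- The vectors `ψ_ρ = Σ_γ w_{(x,b/a)}(γ − ρ)|γ⟩` are eigenvectors of the upper
off-diagonal entry `λ u⁻¹(a − b v)` of the one-site L-operator, with eigenvalue
`a·x·ω^{−ρ}` (for `λ = 1`):  `u⁻¹(a·id − b·v)ψ_ρ = a x ω^{−ρ} ψ_ρ`. -/
theorem bbs_one_site_eigenvector
    (N : ℕ) (hN : 2 ≤ N)
    (ω : ℂ) (hω : ω = Complex.exp (2 * Real.pi * Complex.I / N))
    (a b : ℂ) (ha : a ≠ 0)
    (x : ℂ) (hx : x ^ N = 1 - (b / a) ^ N) (hx1 : x ^ N ≠ 1)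
    (ψ : ZMod N → (ZMod N → ℂ))
    (hψ : ∀ ρ, ψ ρ = fun γ => wfun N ω (x, b / a) (γ - ρ)) :
    ∀ ρ : ZMod N,
      (U1inv N ω * (a • (1 : Module.End ℂ (ZMod N → ℂ)) - b • V1 N)) (ψ ρ) =
        (a * x * ω ^ (-ρ).val) • ψ ρ := by
  intro ρ
  have : NeZero N := ⟨by omega⟩
  have hprim : IsPrimitiveRoot ω N := hω ▸ Complex.isPrimitiveRoot_exp N (by omega)
  funext γ
  have hw := wfun_mul_one_sub hprim (y := b / a) (by rw [hx]; ring) hx1 (γ - ρ)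
  have hpow := pow_zmod_val_add hprim.pow_eq_one (-γ) (γ - ρ)
  rw [show -γ + (γ - ρ) = -ρ by ring] at hpow
  rw [div_mul_eq_mul_div, eq_div_iff ha, sub_right_comm] at hw
  rw [hψ, hpow]
  change ω ^ (-γ).val * (a * wfun N ω (x, b / a) (γ - ρ) -
    b * wfun N ω (x, b / a) (γ - 1 - ρ)) = _ * wfun N ω (x, b / a) (γ - ρ)
  rw [← hw]
  ring
end
end
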